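/- arXiv:0804.3048 — 2 statements merged into one kernel-verified Lean document; each statement's English description precedes it below -/
import Mathlib

section
/- Define f : ℝ³ → ℝ³ by f(r, θ₁, θ₂) = ((θ₁ − θ₂)/2, 1 − 2r², (θ₁ + θ₂)/2). Then for every point p = (r, θ₁, θ₂) ∈ ℝ³ and every vector w = (w_r, w₁, w₂) ∈ ℝ³, writing β for the 1-form on ℝ³ given by β_{(x,y,z)}(v) = v_z − y·v_x (so β = dz − y dx, the standard contact form on ℝ³), one has β_{f(p)}((Df)_p(w)) = r²·w₁ + (1 − r²)·w₂. In particular, (Df)_p(w) ∈ ker β_{f(p)} if and only if r²·w₁ + (1 − r²)·w₂ = 0; that is, f pulls back the standard contact form dz − y dx on ℝ³ to the form r² dθ₁ + (1 − r²) dθ₂ defining ξ_st, so f induces a contactomorphism from its domain onto its image. -/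
/-- The map `f(r, θ₁, θ₂) = ((θ₁ − θ₂)/2, 1 − 2r², (θ₁ + θ₂)/2)` pulls back the standard
contact form `β = dz − y dx` on `ℝ³` to `r² dθ₁ + (1 − r²) dθ₂`: for every point `p` and
vector `w`, `β_{f(p)}((Df)_p(w)) = r²·w₁ + (1 − r²)·w₂`; in particular `(Df)_p(w)` lies in
`ker β_{f(p)}` iff `r²·w₁ + (1 − r²)·w₂ = 0`, so `f` induces a contactomorphism onto its
image. -/
theorem stmt_8 (f : ℝ × ℝ × ℝ → ℝ × ℝ × ℝ)
    (hf : ∀ r θ₁ θ₂ : ℝ, f (r, θ₁, θ₂) = ((θ₁ - θ₂) / 2, 1 - 2 * r ^ 2, (θ₁ + θ₂) / 2))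
    (β : ℝ × ℝ × ℝ → ℝ × ℝ × ℝ → ℝ)
    (hβ : ∀ p v : ℝ × ℝ × ℝ, β p v = v.2.2 - p.2.1 * v.1) :
    ∀ p w : ℝ × ℝ × ℝ,
      β (f p) (fderiv ℝ f p w) = p.1 ^ 2 * w.2.1 + (1 - p.1 ^ 2) * w.2.2 ∧
      (β (f p) (fderiv ℝ f p w) = 0 ↔ p.1 ^ 2 * w.2.1 + (1 - p.1 ^ 2) * w.2.2 = 0) := by
  intro p w
  have hfe : f = fun q : ℝ × ℝ × ℝ =>
      ((q.2.1 - q.2.2) / 2, 1 - 2 * q.1 ^ 2, (q.2.1 + q.2.2) / 2) := by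
    funext q
    exact hf q.1 q.2.1 q.2.2
  have h1 : HasFDerivAt (fun q : ℝ × ℝ × ℝ => q.1) (ContinuousLinearMap.fst ℝ ℝ (ℝ × ℝ)) p :=
    hasFDerivAt_fst
  have hs : HasFDerivAt (fun q : ℝ × ℝ × ℝ => q.2) (ContinuousLinearMap.snd ℝ ℝ (ℝ × ℝ)) p :=
    hasFDerivAt_snd
  have h2 := hs.fst
  have h3 := hs.snd
  have hx := (h2.sub h3).mul_const (2⁻¹ : ℝ)
  have hy := ((h1.pow 2).const_mul (2 : ℝ)).const_sub 1
  have hz := (h2.add h3).mul_const (2⁻¹ : ℝ)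
  have hD := (hx.prodMk (hy.prodMk hz)).fderiv
  have key : β (f p) (fderiv ℝ f p w) = p.1 ^ 2 * w.2.1 + (1 - p.1 ^ 2) * w.2.2 := by
    rw [hβ, hfe]
    simp only [div_eq_mul_inv]
    erw [hD]
    simp
    ring
  exact ⟨key, by rw [key]⟩
end

section
/- Let e : ℤ² × ℤ² → ℤ be the standard determinant pairing e((a₁,a₂),(b₁,b₂)) = a₁b₂ − a₂b₁. Let p ∈ ℤ, let ε ∈ {1, −1}, and let μ, γ, μ', λ' ∈ ℤ² satisfy e(μ', λ') = 1, e(μ, γ) = 1, and μ = p·μ' + ε·λ'. Then there exists k ∈ ℤ such that γ = (k·p − ε)·μ' + (ε·k)·λ', and consequently e(γ, λ') = k·p − ε, so that e(γ, λ') ≡ −ε (mod p). (This is the homological computation proving Proposition 6.1 of the paper: if a knot K in L(p,q) admits an integral surgery yielding an integer homology sphere, then for any Legendrian representative L_K of K with respect to (L(p,q), ξ_UT), the quantity p·tb(L_K) = e(γ, λ') is congruent to ±1 mod p.) -/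
/-- Homological computation proving Proposition 6.1 of the paper: with `e` the intersection
pairing on `H₁(T²;ℤ) ≅ ℤ²`, if `e(μ',λ') = 1`, `e(μ,γ) = 1` and `μ = p·μ' + ε·λ'`
(`ε = ±1`), then `γ = (kp − ε)·μ' + (εk)·λ'` for some `k ∈ ℤ`, hence
`e(γ,λ') = kp − ε ≡ −ε (mod p)`.  Thus for a knot `K ⊂ L(p,q)` admitting an integral
surgery to an integer homology sphere, `p·tb(L_K) = e(γ,λ')` is `≡ ±1 (mod p)` for any
Legendrian representative `L_K`. -/
theorem stmt_12 (e : ℤ × ℤ → ℤ × ℤ → ℤ)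
    (he : ∀ a b : ℤ × ℤ, e a b = a.1 * b.2 - a.2 * b.1)
    (p ε : ℤ) (hε : ε = 1 ∨ ε = -1)
    (μ γ μ' lam' : ℤ × ℤ)
    (h1 : e μ' lam' = 1) (h2 : e μ γ = 1) (h3 : μ = p • μ' + ε • lam') :
    ∃ k : ℤ, γ = (k * p - ε) • μ' + (ε * k) • lam' ∧
      e γ lam' = k * p - ε ∧ e γ lam' ≡ -ε [ZMOD p] := by
  have hεε : ε * ε = 1 := by rcases hε with h | h <;> rw [h] <;> norm_num
  obtain ⟨a, b⟩ := μ'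
  obtain ⟨c, d⟩ := lam'
  obtain ⟨g, h⟩ := γ
  subst h3
  simp only [he, Prod.fst_add, Prod.snd_add, Prod.smul_fst, Prod.smul_snd, smul_eq_mul] at h1 h2 ⊢
  have hx : g * d - h * c = ε * (a * h - b * g) * p - ε := by
    linear_combination (-ε) * h2 - (g * d - h * c) * hεε
  have hy : ε * (ε * (a * h - b * g)) = a * h - b * g := by
    linear_combination (a * h - b * g) * hεε
  refine ⟨ε * (a * h - b * g), ?_, hx, ?_⟩
  · rw [← hx, hy]
    ext
    · simp only [Prod.fst_add, Prod.smul_fst, smul_eq_mul]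
      linear_combination (-g) * h1
    · simp only [Prod.snd_add, Prod.smul_snd, smul_eq_mul]
      linear_combination (-h) * h1
  · rw [hx]
    exact (Int.modEq_iff_dvd.mpr ⟨-(ε * (a * h - b * g)), by ring⟩)
end
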